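/- Let X be a stationary, strongly mixing random field on A^{ℤ²} with probability measure Q and let l : A × D → [0, l_max] be a bounded loss function. Let F = {F_n} be a sequence of sets of λ scandictors (F_n for V_n) and assume the finite-set scandictability U_F(l,Q) = lim_{n→∞} min_{(Ψ,F)∈F_n} E_{Q_{V_n}}[(1/|V_n|) L_{(Ψ,F)}(X_{V_n})] exists. Then there is a function δ(m) with δ(m) → 0 as m → ∞ such that, if the block exponential-weighting algorithm is run with a fixed block size m (using the expert set F_m), then liminf_{n→∞} (1/|V_n|) L_alg(X_{V_n}) ≤ U_F(l,Q) + δ(m) almost surely, jointly with respect to Q and the algorithm's internal randomization. -/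

import Mathlib

open MeasureTheory Filter Real

namespace Scandiction

variable {A D B : Type*}

def visits (Ψ : ∀ t : ℕ, (Fin t → A) → B) (x : B → A) : ℕ → B
  | t => Ψ t fun i : Fin t => x (visits Ψ x i)
  decreasing_by exact i.isLt

def IsValidScan [Fintype B] (Ψ : ∀ t : ℕ, (Fin t → A) → B) : Prop :=
  ∀ x : B → A, Function.Bijective fun t : Fin (Fintype.card B) => visits Ψ x t.1

noncomputable def cumLoss [Fintype B] (l : A → D → ℝ)
    (Ψ : ∀ t : ℕ, (Fin t → A) → B) (F : ∀ t : ℕ, (Fin t → A) → D) (x : B → A) : ℝ :=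
  ∑ t : Fin (Fintype.card B),
    l (x (visits Ψ x t.1)) (F t.1 fun i : Fin t.1 => x (visits Ψ x i.1))

structure Scandictor (A D B : Type*) [Fintype B] where
  scan : ∀ t : ℕ, (Fin t → A) → B
  pred : ∀ t : ℕ, (Fin t → A) → D
  valid : IsValidScan scan

noncomputable def sLoss [Fintype B] (l : A → D → ℝ) (S : Scandictor A D B) (x : B → A) : ℝ :=
  cumLoss l S.scan S.pred x

section ExpWeighting

variable {J : Type*}

/-- Cumulative loss of expert `j` on the first `i` blocks, given per-block losses `bl`. -/
noncomputable def cumBlockLoss (bl : J → ℕ → ℝ) (j : J) (i : ℕ) : ℝ :=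
  ∑ a ∈ Finset.range i, bl j a

/-- The exponential-weighting probability assigned to expert `j` after `i` blocks. -/
noncomputable def expWeight [Fintype J] (η : ℝ) (bl : J → ℕ → ℝ) (i : ℕ) (j : J) : ℝ :=
  Real.exp (-η * cumBlockLoss bl j i) / ∑ j' : J, Real.exp (-η * cumBlockLoss bl j' i)

/-- The parameter `η = 2√(2 log λ) / (m · l_max · (n+m))`. -/
noncomputable def ewEta (n m : ℕ) (lmax : ℝ) (lam : ℕ) : ℝ :=
  2 * Real.sqrt (2 * Real.log lam) / ((m : ℝ) * lmax * ((n : ℝ) + (m : ℝ)))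

/-- `K = ⌈n/m⌉ - 1`. -/
def Kq (n m : ℕ) : ℕ := (n + m - 1) / m - 1

/-- Value of the array `x` at site `(p,q)` (arbitrary value off the array). -/
noncomputable def siteVal [Nonempty A] {n : ℕ} (x : Fin n × Fin n → A) (p q : ℕ) : A :=
  if h : p < n ∧ q < n then x (⟨p, h.1⟩, ⟨q, h.2⟩) else Classical.arbitrary A

/-- The `a`-th full `m × m` block of the `n × n` array `x`, the `K × K` full blocks being
indexed in raster order. -/
noncomputable def blockImage [Nonempty A] (n m : ℕ) (x : Fin n × Fin n → A) (a : ℕ) :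
    Fin m × Fin m → A :=
  fun p => siteVal x ((a / Kq n m) * m + p.1.1) ((a % Kq n m) * m + p.2.1)

/-- Per-block loss of expert `j` (a scandictor for `V_m`, restarted on each full block). -/
noncomputable def blockLoss [Nonempty A] (l : A → D → ℝ) (n m : ℕ)
    (S : J → Scandictor A D (Fin m × Fin m)) (x : Fin n × Fin n → A) (j : J) (a : ℕ) : ℝ :=
  sLoss l (S j) (blockImage n m x a)

/-- Total loss charged on the `2K+1` boundary blocks: `l_max` per site. -/
noncomputable def boundaryLoss (n m : ℕ) (lmax : ℝ) : ℝ :=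
  ((n * n - Kq n m * Kq n m * (m * m) : ℕ) : ℝ) * lmax

/-- Expected cumulative loss of the block exponential-weighting algorithm over `T` blocks
(expectation over its internal randomization). -/
noncomputable def ewExpectedLoss [Fintype J] (η : ℝ) (bl : J → ℕ → ℝ) (T : ℕ) : ℝ :=
  ∑ i ∈ Finset.range T, ∑ j : J, expWeight η bl i j * bl j i

/-- Realized cumulative loss of the algorithm over `T` blocks under the selections `ω`. -/
noncomputable def ewRealizedLoss (bl : J → ℕ → ℝ) (T : ℕ) (ω : ℕ → J) : ℝ :=
  ∑ i ∈ Finset.range T, bl (ω i) i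

/-- Probability that the algorithm's independent randomized selections realize `ω`. -/
noncomputable def selProb [Fintype J] (η : ℝ) (bl : J → ℕ → ℝ) (T : ℕ) (ω : Fin T → J) : ℝ :=
  ∏ i : Fin T, expWeight η bl i.1 (ω i)

end ExpWeighting

/-- Restriction of a configuration on `ℤ²` to the `n × n` square `V_n`. -/
def restrV {A : Type*} (n : ℕ) (x : ℤ × ℤ → A) : Fin n × Fin n → A :=
  fun p => x ((p.1 : ℤ), (p.2 : ℤ))

/-- Translation of a configuration by `i ∈ ℤ²`: `(τ_i x)_j = x_{j+i}`. -/
def shift {A : Type*} (i : ℤ × ℤ) (x : ℤ × ℤ → A) : ℤ × ℤ → A := fun j => x (j + i)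

/-- A probability measure on `A^{ℤ²}` is stationary if it is invariant under every
translation. -/
def Stationary {A : Type*} [MeasurableSpace A]
    (Q : MeasureTheory.Measure ((ℤ × ℤ) → A)) : Prop :=
  ∀ i : ℤ × ℤ, MeasureTheory.Measure.map (shift i) Q = Q

/-- The σ-algebra `σ(X_S)` generated by the coordinates in `S ⊆ ℤ²`. -/
def cylSigma {A : Type*} [MeasurableSpace A] (S : Set (ℤ × ℤ)) :
    MeasurableSpace ((ℤ × ℤ) → A) :=
  MeasurableSpace.comap (fun x (i : S) => x i.1) inferInstance

/-- `α^Q(S,T) = sup { |Q(U∩V) − Q(U)Q(V)| : U ∈ σ(X_S), V ∈ σ(X_T) }`. -/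
noncomputable def alphaPair {A : Type*} [MeasurableSpace A]
    (Q : MeasureTheory.Measure ((ℤ × ℤ) → A)) (S T : Set (ℤ × ℤ)) : ℝ :=
  ⨆ p : {UV : Set ((ℤ × ℤ) → A) × Set ((ℤ × ℤ) → A) //
      MeasurableSet[cylSigma S] UV.1 ∧ MeasurableSet[cylSigma T] UV.2},
    |(Q (p.1.1 ∩ p.1.2)).toReal - (Q p.1.1).toReal * (Q p.1.2).toReal|

/-- A metric on `ℤ²` (the `l¹` distance). -/
def siteDist (p q : ℤ × ℤ) : ℕ := (p.1 - q.1).natAbs + (p.2 - q.2).natAbs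

/-- The strong mixing coefficient
`α^Q_{a,b}(k) = sup { α^Q(S,T) : |S| ≤ a, |T| ≤ b, d(S,T) ≥ k }`, `a, b ∈ ℕ ∪ {∞}`. -/
noncomputable def mixCoef {A : Type*} [MeasurableSpace A]
    (Q : MeasureTheory.Measure ((ℤ × ℤ) → A)) (a b : ℕ∞) (k : ℕ) : ℝ :=
  ⨆ p : {ST : Set (ℤ × ℤ) × Set (ℤ × ℤ) //
      ST.1.encard ≤ a ∧ ST.2.encard ≤ b ∧ ∀ s ∈ ST.1, ∀ t ∈ ST.2, k ≤ siteDist s t},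
    alphaPair Q p.1.1 p.1.2

/-- `Q` is strongly mixing: `α^Q_{a,b}(k) → 0` as `k → ∞` for all `a, b ∈ ℕ ∪ {∞}`. -/
def StronglyMixing {A : Type*} [MeasurableSpace A]
    (Q : MeasureTheory.Measure ((ℤ × ℤ) → A)) : Prop :=
  ∀ a b : ℕ∞, Filter.Tendsto (fun k => mixCoef Q a b k) Filter.atTop (nhds 0)

lemma sum_range_mul_eq (g : ℕ → ℝ) (L K : ℕ) :
    ∑ a ∈ Finset.range (L * K), g a =
      ∑ r ∈ Finset.range L, ∑ s ∈ Finset.range K, g (r * K + s) := by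
  induction L with
  | zero => simp
  | succ L ih => rw [Nat.succ_mul, Finset.sum_range_add, ih, Finset.sum_range_succ]

lemma sum_sum_dist_le {β : ℕ → ℝ} (hβ : ∀ r, 0 ≤ β r) (K : ℕ) :
    ∑ s ∈ Finset.range K, ∑ t ∈ Finset.range K, β (Nat.dist s t) ≤
      2 * K * ∑ r ∈ Finset.range K, β r := by
  induction K with
  | zero => simp
  | succ K ih =>
    have hrow : ∑ t ∈ Finset.range K, β (Nat.dist K t) + β 0 =
        ∑ r ∈ Finset.range (K + 1), β r := by
      rw [← Finset.sum_range_reflect β (K + 1), Finset.sum_range_succ]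
      congr 1
      · refine Finset.sum_congr rfl fun t ht => ?_
        have := Finset.mem_range.1 ht
        congr 1
        rw [Nat.dist]; omega
      · congr 1; omega
    have hcol : ∑ s ∈ Finset.range K, β (Nat.dist s K) =
        ∑ t ∈ Finset.range K, β (Nat.dist K t) :=
      Finset.sum_congr rfl fun s _ => by rw [Nat.dist_comm]
    have hK : ∑ r ∈ Finset.range (K + 1), β r = ∑ r ∈ Finset.range K, β r + β K :=
      Finset.sum_range_succ _ _
    have h0 : Nat.dist K K = 0 := Nat.dist_self K
    simp only [Finset.sum_range_succ _ K, Finset.sum_add_distrib, h0] at *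
    have h1 := mul_nonneg (Nat.cast_nonneg (α := ℝ) K) (hβ K)
    push_cast
    nlinarith [hβ 0, hβ K]

lemma exp_neg_le_quadratic {x : ℝ} (hx : 0 ≤ x) : Real.exp (-x) ≤ 1 - x + x ^ 2 / 2 := by
  rw [Real.exp_neg]
  have h := Real.quadratic_le_exp_of_nonneg hx
  have h1 : 0 < 1 + x + x ^ 2 / 2 := by positivity
  refine (inv_anti₀ h1 h).trans ?_
  rw [inv_le_iff_one_le_mul₀ h1]
  nlinarith [sq_nonneg (x ^ 2)]

section Regret

variable {J : Type*} [Fintype J]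

lemma expWeight_nonneg (η : ℝ) (bl : J → ℕ → ℝ) (i : ℕ) (j : J) : 0 ≤ expWeight η bl i j := by
  unfold expWeight
  positivity

lemma sum_expWeight [Nonempty J] (η : ℝ) (bl : J → ℕ → ℝ) (i : ℕ) :
    ∑ j, expWeight η bl i j = 1 := by
  unfold expWeight
  rw [← Finset.sum_div]
  exact div_self (Finset.sum_pos (fun j _ => Real.exp_pos _) Finset.univ_nonempty).ne'

lemma expWeight_le_one [Nonempty J] (η : ℝ) (bl : J → ℕ → ℝ) (i : ℕ) (j : J) :
    expWeight η bl i j ≤ 1 := by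
  rw [← sum_expWeight η bl i]
  exact Finset.single_le_sum (fun j _ => expWeight_nonneg η bl i j) (Finset.mem_univ j)

/-- Logarithmic potential bound of the exponential-weighting forecaster. -/
lemma sum_exp_cumBlockLoss_le [Nonempty J] {η C : ℝ} (hη : 0 ≤ η) {bl : J → ℕ → ℝ} {T : ℕ}
    (hbl : ∀ j, ∀ i < T, bl j i ∈ Set.Icc 0 C) :
    ∑ j, Real.exp (-η * cumBlockLoss bl j T) ≤
      Fintype.card J * Real.exp (-η * ewExpectedLoss η bl T + T * (η ^ 2 * C ^ 2 / 2)) := by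
  induction T with
  | zero => simp [cumBlockLoss, ewExpectedLoss]
  | succ T ih =>
    have ih' := ih fun j i hi => hbl j i (hi.trans (Nat.lt_succ_self T))
    set W := ∑ j, Real.exp (-η * cumBlockLoss bl j T) with hW
    have hWpos : 0 < W := Finset.sum_pos (fun j _ => Real.exp_pos _) Finset.univ_nonempty
    have hterm : ∀ j, Real.exp (-η * cumBlockLoss bl j (T + 1)) ≤
        W * (expWeight η bl T j * (1 + η ^ 2 * C ^ 2 / 2) -
          η * (expWeight η bl T j * bl j T)) := by
      intro j
      have hb := hbl j T (Nat.lt_succ_self T)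
      have hx : 0 ≤ η * bl j T := mul_nonneg hη hb.1
      have hsq : (η * bl j T) ^ 2 ≤ η ^ 2 * C ^ 2 := by
        rw [mul_pow]
        exact mul_le_mul_of_nonneg_left (pow_le_pow_left₀ hb.1 hb.2 2) (sq_nonneg η)
      have hw : W * expWeight η bl T j = Real.exp (-η * cumBlockLoss bl j T) := by
        unfold expWeight
        rw [← hW]
        field_simp
      have he : Real.exp (-η * cumBlockLoss bl j (T + 1)) =
          W * expWeight η bl T j * Real.exp (-(η * bl j T)) := by
        rw [hw, ← Real.exp_add, cumBlockLoss, Finset.sum_range_succ, ← cumBlockLoss]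
        congr 1; ring
      rw [he]
      calc _ ≤ W * expWeight η bl T j * (1 - η * bl j T + η ^ 2 * C ^ 2 / 2) := by
            refine mul_le_mul_of_nonneg_left ?_
              (mul_nonneg hWpos.le (expWeight_nonneg _ _ _ _))
            linarith [exp_neg_le_quadratic hx]
        _ = _ := by ring
    calc _ ≤ ∑ j, W * (expWeight η bl T j * (1 + η ^ 2 * C ^ 2 / 2) -
          η * (expWeight η bl T j * bl j T)) := Finset.sum_le_sum fun j _ => hterm j
      _ = W * (1 + η ^ 2 * C ^ 2 / 2 - η * ∑ j, expWeight η bl T j * bl j T) := by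
        rw [← Finset.mul_sum, Finset.sum_sub_distrib, ← Finset.sum_mul, sum_expWeight,
          ← Finset.mul_sum, one_mul]
      _ ≤ W * Real.exp (η ^ 2 * C ^ 2 / 2 - η * ∑ j, expWeight η bl T j * bl j T) := by
        refine mul_le_mul_of_nonneg_left ?_ hWpos.le
        linarith [Real.add_one_le_exp (η ^ 2 * C ^ 2 / 2 - η * ∑ j, expWeight η bl T j * bl j T)]
      _ ≤ (Fintype.card J *
            Real.exp (-η * ewExpectedLoss η bl T + T * (η ^ 2 * C ^ 2 / 2))) *
          Real.exp (η ^ 2 * C ^ 2 / 2 - η * ∑ j, expWeight η bl T j * bl j T) :=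
        mul_le_mul_of_nonneg_right ih' (Real.exp_pos _).le
      _ = _ := by
        rw [mul_assoc, ← Real.exp_add]
        unfold ewExpectedLoss
        rw [Finset.sum_range_succ]
        push_cast
        congr 2; ring

lemma mul_ewExpectedLoss_le [Nonempty J] {η C : ℝ} (hη : 0 ≤ η) {bl : J → ℕ → ℝ} {T : ℕ}
    (hbl : ∀ j, ∀ i < T, bl j i ∈ Set.Icc 0 C) (j : J) :
    η * ewExpectedLoss η bl T ≤
      η * cumBlockLoss bl j T + Real.log (Fintype.card J) + T * (η ^ 2 * C ^ 2 / 2) := by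
  have h := (Finset.single_le_sum (f := fun j => Real.exp (-η * cumBlockLoss bl j T))
    (fun j _ => (Real.exp_pos _).le) (Finset.mem_univ j)).trans (sum_exp_cumBlockLoss_le hη hbl)
  have hc : (0 : ℝ) < Fintype.card J := by exact_mod_cast Fintype.card_pos
  have h2 := Real.log_le_log (Real.exp_pos _) h
  rw [Real.log_exp, Real.log_mul hc.ne' (Real.exp_pos _).ne', Real.log_exp] at h2
  linarith

/-- Regret bound for the learning rate `ewEta`. -/
lemma ewExpectedLoss_ewEta_le {lam : ℕ} (hlam : 0 < lam) {lmax : ℝ} (hlmax : 0 ≤ lmax) {n m T : ℕ}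
    (hm : 0 < m) (hT : T ≤ n ^ 2) {bl : Fin lam → ℕ → ℝ}
    (hbl : ∀ j, ∀ i < T, bl j i ∈ Set.Icc 0 ((m : ℝ) ^ 2 * lmax)) (j : Fin lam) :
    ewExpectedLoss (ewEta n m lmax lam) bl T ≤ cumBlockLoss bl j T +
      2 * Real.sqrt (2 * Real.log lam) * m ^ 3 * lmax * (n + m) := by
  have : Nonempty (Fin lam) := ⟨j⟩
  have hm1 : (1 : ℝ) ≤ m := by exact_mod_cast hm
  have hn0 : (0 : ℝ) ≤ n := Nat.cast_nonneg n
  rcases hlmax.eq_or_lt with h0 | hpos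
  · have hz : ∀ j, ∀ i < T, bl j i = 0 := fun j i hi => by
      have := hbl j i hi
      rw [← h0, mul_zero] at this
      exact le_antisymm this.2 this.1
    have h1 : ewExpectedLoss (ewEta n m lmax lam) bl T = 0 :=
      Finset.sum_eq_zero fun i hi => Finset.sum_eq_zero fun j _ => by
        rw [hz j i (Finset.mem_range.1 hi), mul_zero]
    have h2 : cumBlockLoss bl j T = 0 :=
      Finset.sum_eq_zero fun i hi => hz j i (Finset.mem_range.1 hi)
    rw [h1, h2, ← h0]; simp
  rcases (Nat.succ_le_of_lt hlam).eq_or_lt with h1 | h1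
  · subst h1
    have : ewExpectedLoss (ewEta n m lmax 1) bl T = cumBlockLoss bl j T := by
      refine Finset.sum_congr rfl fun i _ => ?_
      have hw := sum_expWeight (ewEta n m lmax 1) bl i
      rw [Fintype.sum_subsingleton _ j] at hw ⊢
      rw [hw, one_mul]
    rw [this]; simp
  · have hlog : 0 < Real.log lam := Real.log_pos (by exact_mod_cast h1)
    set q := Real.sqrt (2 * Real.log lam) with hq
    have hqpos : 0 < q := Real.sqrt_pos.2 (by positivity)
    have hq2 : q ^ 2 = 2 * Real.log lam := Real.sq_sqrt (by positivity)
    set η := ewEta n m lmax lam with hη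
    have hηe : η = 2 * q / (m * lmax * (n + m)) := rfl
    have hden : 0 < (m : ℝ) * lmax * (n + m) := by positivity
    have hηpos : 0 < η := by rw [hηe]; positivity
    have hprod : η * (m * lmax * (n + m)) = 2 * q := by rw [hηe]; field_simp
    have hreg := mul_ewExpectedLoss_le hηpos.le hbl j
    rw [Fintype.card_fin] at hreg
    refine le_of_mul_le_mul_left (hreg.trans ?_) hηpos
    have hTn : (T : ℝ) ≤ (n + m) ^ 2 := by
      have : (T : ℝ) ≤ n ^ 2 := by exact_mod_cast hT
      nlinarith
    have e1 : η * (2 * q * m ^ 3 * lmax * (n + m)) = 4 * q ^ 2 * m ^ 2 := by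
      linear_combination (2 * q * m ^ 2) * hprod
    have e2 : (n + m : ℝ) ^ 2 * (η ^ 2 * ((m : ℝ) ^ 2 * lmax) ^ 2 / 2) = 2 * q ^ 2 * m ^ 2 := by
      have : (η * (m * lmax * (n + m))) ^ 2 = (2 * q) ^ 2 := by rw [hprod]
      linear_combination ((m : ℝ) ^ 2 / 2) * this
    have e3 : (T : ℝ) * (η ^ 2 * ((m : ℝ) ^ 2 * lmax) ^ 2 / 2) ≤ 2 * q ^ 2 * m ^ 2 := by
      rw [← e2]
      exact mul_le_mul_of_nonneg_right hTn (by positivity)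
    have e4 : Real.log lam ≤ q ^ 2 * m ^ 2 := by
      nlinarith [one_le_pow₀ hm1 (n := 2), sq_nonneg q]
    rw [mul_add, e1]
    nlinarith [mul_pos (pow_pos hqpos 2) (pow_pos (zero_lt_one.trans_le hm1) 2)]

end Regret

section Probability

variable {Ω 𝓧 : Type*} [MeasurableSpace Ω] [MeasurableSpace 𝓧]

lemma abs_integral_sub_integral_le {ν₁ ν₂ : Measure 𝓧} [IsFiniteMeasure ν₁] [IsFiniteMeasure ν₂]
    {g : 𝓧 → ℝ} (hg : Measurable g) {C a : ℝ} (hC : 0 ≤ C) (hgC : ∀ x, g x ∈ Set.Icc 0 C)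
    (h : ∀ t, |ν₁.real {x | t ≤ g x} - ν₂.real {x | t ≤ g x}| ≤ a) :
    |∫ x, g x ∂ν₁ - ∫ x, g x ∂ν₂| ≤ C * a := by
  have hint : ∀ (ν : Measure 𝓧) [IsFiniteMeasure ν], Integrable g ν := fun ν _ =>
    Integrable.of_bound hg.aestronglyMeasurable C
      (ae_of_all _ fun x => by rw [Real.norm_of_nonneg (hgC x).1]; exact (hgC x).2)
  have hlc : ∀ (ν : Measure 𝓧) [IsFiniteMeasure ν],
      ∫ x, g x ∂ν = ∫ t in Set.Ioc 0 C, ν.real {x | t ≤ g x} := fun ν _ =>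
    (hint ν).integral_eq_integral_Ioc_meas_le (ae_of_all _ fun x => (hgC x).1)
      (ae_of_all _ fun x => (hgC x).2)
  have hanti : ∀ (ν : Measure 𝓧) [IsFiniteMeasure ν],
      IntegrableOn (fun t => ν.real {x | t ≤ g x}) (Set.Ioc 0 C) := fun ν _ => by
    have hm : Antitone fun t => ν.real {x | t ≤ g x} := fun s t hst =>
      measureReal_mono fun x (hx : t ≤ g x) => hst.trans hx
    exact (hm.locallyIntegrable.integrableOn_isCompact isCompact_Icc).mono_set
      Set.Ioc_subset_Icc_self
  rw [hlc ν₁, hlc ν₂, ← integral_sub (hanti ν₁) (hanti ν₂)]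
  have := norm_setIntegral_le_of_norm_le_const (μ := volume) (s := Set.Ioc 0 C) (C := a)
    (f := fun t => ν₁.real {x | t ≤ g x} - ν₂.real {x | t ≤ g x}) (by simp) fun t _ => h t
  simpa [hC, mul_comm] using this

/-- Covariance inequality for bounded functions under an `α`-mixing bound. -/
lemma abs_integral_mul_sub_le {Q : Measure 𝓧} [IsProbabilityMeasure Q] {f g : 𝓧 → ℝ}
    (hf : Measurable f) (hg : Measurable g) {C a : ℝ} (hC : 0 ≤ C)
    (hfC : ∀ x, f x ∈ Set.Icc 0 C) (hgC : ∀ x, g x ∈ Set.Icc 0 C)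
    (h : ∀ s t, |Q.real ({x | s ≤ f x} ∩ {x | t ≤ g x}) -
      Q.real {x | s ≤ f x} * Q.real {x | t ≤ g x}| ≤ a) :
    |∫ x, f x * g x ∂Q - (∫ x, f x ∂Q) * ∫ x, g x ∂Q| ≤ C ^ 2 * a := by
  have hfi : Integrable f Q := Integrable.of_bound hf.aestronglyMeasurable C
      (ae_of_all _ fun x => by rw [Real.norm_of_nonneg (hfC x).1]; exact (hfC x).2)
  have hset : ∀ t, |∫ x in {x | t ≤ g x}, f x ∂Q - Q.real {x | t ≤ g x} * ∫ x, f x ∂Q| ≤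
      C * a := by
    intro t
    have hc : Q {x | t ≤ g x} ≠ ⊤ := measure_ne_top _ _
    have : IsFiniteMeasure (Q {x | t ≤ g x} • Q) := Measure.smul_finite Q hc
    have := abs_integral_sub_integral_le (ν₁ := Q.restrict {x | t ≤ g x})
      (ν₂ := Q {x | t ≤ g x} • Q) hf hC hfC (a := a) fun s => by
        rw [measureReal_restrict_apply (measurableSet_le measurable_const hf),
          measureReal_ennreal_smul_apply]
        have := h s t
        rwa [mul_comm (Q.real {x | s ≤ f x})] at this
    rwa [integral_smul_measure] at this
  have hfin : ∫⁻ x, ENNReal.ofReal (f x) ∂Q ≠ ⊤ := hfi.lintegral_lt_top.ne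
  have : IsFiniteMeasure (Q.withDensity fun x => ENNReal.ofReal (f x)) :=
    isFiniteMeasure_withDensity hfin
  have : IsFiniteMeasure (ENNReal.ofReal (∫ x, f x ∂Q) • Q) :=
    Measure.smul_finite Q ENNReal.ofReal_ne_top
  have key := abs_integral_sub_integral_le (ν₁ := Q.withDensity fun x => ENNReal.ofReal (f x))
    (ν₂ := ENNReal.ofReal (∫ x, f x ∂Q) • Q) hg hC hgC (a := C * a) fun t => by
      have hmt : MeasurableSet {x | t ≤ g x} := measurableSet_le measurable_const hg
      have e1 : (Q.withDensity fun x => ENNReal.ofReal (f x)).real {x | t ≤ g x} =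
          ∫ x in {x | t ≤ g x}, f x ∂Q := by
        rw [Measure.real, withDensity_apply _ hmt,
          integral_eq_lintegral_of_nonneg_ae (ae_of_all _ fun x => (hfC x).1)
            hf.aestronglyMeasurable]
      rw [e1, measureReal_ennreal_smul_apply,
        ENNReal.toReal_ofReal (integral_nonneg fun x => (hfC x).1), mul_comm (∫ x, f x ∂Q)]
      exact hset t
  rw [integral_withDensity_eq_integral_toReal_smul hf.ennreal_ofReal (by simp),
    integral_smul_measure, ENNReal.toReal_ofReal (integral_nonneg fun x => (hfC x).1)] at key
  simp only [ENNReal.toReal_ofReal (hfC _).1, smul_eq_mul] at key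
  rwa [pow_two, mul_assoc]

/-- A weak law in `L²` for sequences with covariances decaying in the index distance. -/
lemma integral_sq_sum_le {Q : Measure 𝓧} {Y : ℕ → 𝓧 → ℝ}
    (hint : ∀ s t, Integrable (fun x => Y s x * Y t x) Q) {β : ℕ → ℝ} (hβ : ∀ r, 0 ≤ β r)
    (hcov : ∀ s t, |∫ x, Y s x * Y t x ∂Q| ≤ β (Nat.dist s t)) (K : ℕ) :
    ∫ x, (∑ s ∈ Finset.range K, Y s x) ^ 2 ∂Q ≤ 2 * K * ∑ r ∈ Finset.range K, β r := by
  refine le_trans ?_ (sum_sum_dist_le hβ K)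
  simp only [pow_two, Finset.sum_mul_sum]
  rw [integral_finsetSum _ fun s _ => integrable_finsetSum _ fun t _ => hint s t]
  refine Finset.sum_le_sum fun s _ => ?_
  rw [integral_finsetSum _ fun t _ => hint s t]
  exact Finset.sum_le_sum fun t _ => (le_abs_self _).trans (hcov s t)

lemma setIntegral_comp_eq_integral_mul {μ : Measure Ω} {Q : Measure 𝓧} {X : Ω → 𝓧}
    (hX : Measurable X) {G : Set Ω} {r : 𝓧 → ℝ} (hr : Measurable r) (hr0 : ∀ x, 0 ≤ r x)
    (h : ∀ E, MeasurableSet E → μ {ω | X ω ∈ E ∧ ω ∈ G} = ∫⁻ x in E, ENNReal.ofReal (r x) ∂Q)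
    {f : 𝓧 → ℝ} (hf : Measurable f) :
    ∫ ω in G, f (X ω) ∂μ = ∫ x, r x * f x ∂Q := by
  have hmap : (μ.restrict G).map X = Q.withDensity fun x => ENNReal.ofReal (r x) := by
    ext E hE
    rw [Measure.map_apply hX hE, Measure.restrict_apply (hX hE), withDensity_apply _ hE, ← h E hE]
    rfl
  rw [← integral_map hX.aemeasurable hf.aestronglyMeasurable, hmap,
    integral_withDensity_eq_integral_toReal_smul hr.ennreal_ofReal (by simp)]
  simp only [ENNReal.toReal_ofReal (hr0 _), smul_eq_mul]

/-- Conditionally independent, conditionally centred bounded terms have summed variance. -/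
lemma integral_sq_sum_centered_le {J : Type*} [Fintype J] [DecidableEq J] [MeasurableSpace J]
    [MeasurableSingletonClass J]
    {μ : Measure Ω} [IsProbabilityMeasure μ] {Q : Measure 𝓧} [IsProbabilityMeasure Q] {X : Ω → 𝓧}
    (hX : Measurable X) {sel : Ω → ℕ → J} (hsel : ∀ i, Measurable fun ω => sel ω i)
    {T : ℕ} {w g : ℕ → J → 𝓧 → ℝ} {C : ℝ}
    (hw : ∀ i < T, ∀ j, Measurable (w i j)) (hw0 : ∀ i j x, 0 ≤ w i j x)
    (hw1 : ∀ i j x, w i j x ≤ 1)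
    (hg : ∀ i < T, ∀ j, Measurable (g i j)) (hgC : ∀ i < T, ∀ j x, |g i j x| ≤ C)
    (hcen : ∀ i < T, ∀ x, ∑ j, w i j x * g i j x = 0)
    (hlaw : ∀ i k, i ≠ k → ∀ c c' E, MeasurableSet E →
      μ {ω | X ω ∈ E ∧ sel ω i = c ∧ sel ω k = c'} =
        ∫⁻ x in E, ENNReal.ofReal (w i c x * w k c' x) ∂Q) :
    ∫ ω, (∑ i ∈ Finset.range T, g i (sel ω i) (X ω)) ^ 2 ∂μ ≤ T * C ^ 2 := by
  have hexp : ∀ i ω, g i (sel ω i) (X ω) =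
      ∑ c, {ω | sel ω i = c}.indicator (fun ω => g i c (X ω)) ω := by
    intro i ω
    simp [Set.indicator_apply]
  have hmeas : ∀ i < T, Measurable fun ω => g i (sel ω i) (X ω) := by
    intro i hi
    simp only [hexp i]
    exact Finset.measurable_fun_sum _ fun c _ =>
      ((hg i hi c).comp hX).indicator (hsel i (measurableSet_singleton c))
  have hbd : ∀ i < T, ∀ k < T, ∀ j j' x y, |g i j x * g k j' y| ≤ C ^ 2 := by
    intro i hi k hk j j' x y
    rw [abs_mul, pow_two]
    exact mul_le_mul (hgC i hi j x) (hgC k hk j' y) (abs_nonneg _)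
      ((abs_nonneg _).trans (hgC i hi j x))
  have hint : ∀ i < T, ∀ k < T,
      Integrable (fun ω => g i (sel ω i) (X ω) * g k (sel ω k) (X ω)) μ := fun i hi k hk =>
    Integrable.of_bound ((hmeas i hi).mul (hmeas k hk)).aestronglyMeasurable (C ^ 2)
      (ae_of_all _ fun ω => hbd i hi k hk _ _ _ _)
  have hoff : ∀ i < T, ∀ k < T, i ≠ k →
      ∫ ω, g i (sel ω i) (X ω) * g k (sel ω k) (X ω) ∂μ = 0 := by
    intro i hi k hk hik
    have hG : ∀ c c', MeasurableSet {ω | sel ω i = c ∧ sel ω k = c'} := fun c c' =>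
      (hsel i (measurableSet_singleton c)).inter (hsel k (measurableSet_singleton c'))
    have hterm : ∀ c c', Measurable fun x => g i c x * g k c' x := fun c c' =>
      (hg i hi c).mul (hg k hk c')
    have e1 : ∀ ω, g i (sel ω i) (X ω) * g k (sel ω k) (X ω) =
        ∑ c, ∑ c', {ω | sel ω i = c ∧ sel ω k = c'}.indicator
          (fun ω => g i c (X ω) * g k c' (X ω)) ω := by
      intro ω
      simp [Set.indicator_apply, ite_and]
    have hI : ∀ c c', Integrable ({ω | sel ω i = c ∧ sel ω k = c'}.indicator
          (fun ω => g i c (X ω) * g k c' (X ω))) μ := fun c c' =>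
      (Integrable.of_bound ((hterm c c').comp hX).aestronglyMeasurable (C ^ 2)
        (ae_of_all _ fun ω => hbd i hi k hk _ _ _ _)).indicator (hG c c')
    have hIQ : ∀ c c', Integrable (fun x => w i c x * w k c' x * (g i c x * g k c' x)) Q := by
      intro c c'
      refine Integrable.of_bound
        (((hw i hi c).mul (hw k hk c')).mul (hterm c c')).aestronglyMeasurable (C ^ 2)
        (ae_of_all _ fun x => ?_)
      rw [norm_mul, Real.norm_of_nonneg (mul_nonneg (hw0 _ _ _) (hw0 _ _ _))]
      have := mul_le_one₀ (hw1 i c x) (hw0 k c' x) (hw1 k c' x)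
      exact (mul_le_of_le_one_left (norm_nonneg _) this).trans (hbd i hi k hk _ _ _ _)
    simp only [e1]
    rw [integral_finsetSum _ fun c _ => integrable_finsetSum _ fun c' _ => hI c c']
    have e2 : ∀ c c', ∫ ω, {ω | sel ω i = c ∧ sel ω k = c'}.indicator
        (fun ω => g i c (X ω) * g k c' (X ω)) ω ∂μ =
        ∫ x, w i c x * w k c' x * (g i c x * g k c' x) ∂Q := by
      intro c c'
      rw [integral_indicator (hG c c')]
      exact setIntegral_comp_eq_integral_mul hX ((hw i hi c).mul (hw k hk c'))
        (fun x => mul_nonneg (hw0 _ _ _) (hw0 _ _ _)) (hlaw i k hik c c') (hterm c c')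
    have e3 : ∀ c, ∫ ω, ∑ c', {ω | sel ω i = c ∧ sel ω k = c'}.indicator
        (fun ω => g i c (X ω) * g k c' (X ω)) ω ∂μ =
        ∫ x, ∑ c', w i c x * w k c' x * (g i c x * g k c' x) ∂Q := by
      intro c
      rw [integral_finsetSum _ fun c' _ => hI c c', integral_finsetSum _ fun c' _ => hIQ c c']
      exact Finset.sum_congr rfl fun c' _ => e2 c c'
    rw [Finset.sum_congr rfl fun c _ => e3 c,
      ← integral_finsetSum _ fun c _ => integrable_finsetSum _ fun c' _ => hIQ c c']
    refine integral_eq_zero_of_ae (ae_of_all _ fun x => ?_)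
    calc _ = (∑ c, w i c x * g i c x) * ∑ c', w k c' x * g k c' x := by
          rw [Finset.sum_mul_sum]
          exact Finset.sum_congr rfl fun c _ => Finset.sum_congr rfl fun c' _ => by ring
      _ = 0 := by rw [hcen i hi x, zero_mul]
  simp only [pow_two (∑ i ∈ Finset.range T, _), Finset.sum_mul_sum]
  rw [integral_finsetSum _ fun i hi => integrable_finsetSum _ fun k hk =>
    hint i (Finset.mem_range.1 hi) k (Finset.mem_range.1 hk)]
  calc _ ≤ ∑ i ∈ Finset.range T, C ^ 2 := by
        refine Finset.sum_le_sum fun i hi => ?_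
        have hi' := Finset.mem_range.1 hi
        rw [integral_finsetSum _ fun k hk => hint i hi' k (Finset.mem_range.1 hk),
          Finset.sum_eq_single i
            (fun k hk hki => hoff i hi' k (Finset.mem_range.1 hk) hki.symm) (absurd hi)]
        calc _ ≤ ∫ _, C ^ 2 ∂μ := integral_mono (hint i hi' i hi') (integrable_const _)
              fun ω => (le_abs_self _).trans (hbd i hi' i hi' _ _ _ _)
          _ = C ^ 2 := by simp
    _ = T * C ^ 2 := by simp

/-- A sequence dominated by a convergent one plus errors vanishing in `L²` has the expected
almost sure bound on its lower limit. -/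
lemma ae_liminf_le_of_integral_sq_tendsto {μ : Measure Ω} {a : ℕ → Ω → ℝ} {b : ℕ → ℝ} {e : ℝ}
    {Y Z : ℕ → Ω → ℝ} (hb : Tendsto b atTop (nhds e)) (ha0 : ∀ n ω, 0 ≤ a n ω)
    (hY : ∀ n, AEStronglyMeasurable (Y n) μ) (hZ : ∀ n, AEStronglyMeasurable (Z n) μ)
    (hYi : ∀ n, Integrable (fun ω => Y n ω ^ 2) μ) (hZi : ∀ n, Integrable (fun ω => Z n ω ^ 2) μ)
    (hY0 : Tendsto (fun n => ∫ ω, Y n ω ^ 2 ∂μ) atTop (nhds 0))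
    (hZ0 : Tendsto (fun n => ∫ ω, Z n ω ^ 2 ∂μ) atTop (nhds 0))
    (hle : ∀ n ω, a n ω ≤ b n + |Y n ω| + |Z n ω|) :
    ∀ᵐ ω ∂μ, liminf (fun n => a n ω) atTop ≤ e := by
  have hL1 : Tendsto (fun n => eLpNorm ((fun ω => Y n ω ^ 2 + Z n ω ^ 2) - 0) 1 μ)
      atTop (nhds 0) := by
    have h := ENNReal.tendsto_ofReal (hY0.add hZ0)
    rw [add_zero, ENNReal.ofReal_zero] at h
    refine h.congr fun n => ?_
    have hi : Integrable (fun ω => Y n ω ^ 2 + Z n ω ^ 2) μ := (hYi n).add (hZi n)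
    rw [sub_zero, eLpNorm_one_eq_lintegral_enorm, ← ofReal_integral_norm_eq_lintegral_enorm hi,
      ← integral_add (hYi n) (hZi n)]
    congr 1
    refine integral_congr_ae (ae_of_all _ fun ω => ?_)
    exact (Real.norm_of_nonneg (by positivity)).symm
  obtain ⟨ns, hns, hae⟩ := (tendstoInMeasure_of_tendsto_eLpNorm one_ne_zero
    (f := fun n ω => Y n ω ^ 2 + Z n ω ^ 2) (g := 0)
    (fun n => ((hY n).pow 2).add ((hZ n).pow 2)) aestronglyMeasurable_const
      hL1).exists_seq_tendsto_ae
  filter_upwards [hae] with ω hω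
  have habs : ∀ V : ℕ → Ω → ℝ, (∀ k, V k ω ^ 2 ≤ Y k ω ^ 2 + Z k ω ^ 2) →
      Tendsto (fun k => |V (ns k) ω|) atTop (nhds 0) := by
    intro V hV
    have h1 : Tendsto (fun k => V (ns k) ω ^ 2) atTop (nhds 0) :=
      squeeze_zero (fun k => sq_nonneg _) (fun k => hV _) hω
    have h2 := h1.sqrt
    simpa only [Real.sqrt_sq_eq_abs, Real.sqrt_zero] using h2
  have hsum := ((hb.comp hns.tendsto_atTop).add
    (habs Y fun k => le_add_of_nonneg_right (sq_nonneg _))).add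
    (habs Z fun k => le_add_of_nonneg_left (sq_nonneg _))
  rw [add_zero, add_zero] at hsum
  refine le_of_forall_pos_le_add fun ε hε => ?_
  have hev : ∀ᶠ k in atTop, a (ns k) ω ≤ e + ε := by
    filter_upwards [hsum.eventually (gt_mem_nhds (lt_add_of_pos_right e hε))] with k hk
    exact (hle (ns k) ω).trans hk.le
  refine liminf_le_of_frequently_le ?_ (isBoundedUnder_of ⟨0, fun n => ha0 n ω⟩)
  exact hns.tendsto_atTop.frequently hev.frequently

end Probability

/-- The sites of the `M × M` square with corner `v`. -/
def boxAt (v : ℤ × ℤ) (M : ℕ) : Set (ℤ × ℤ) :=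
  Set.Ico v.1 (v.1 + M) ×ˢ Set.Ico v.2 (v.2 + M)

lemma dependsOn_comp_shift {A : Type*} {f : ((ℤ × ℤ) → A) → ℝ} {M : ℕ} (hf : DependsOn f (boxAt 0 M))
    (v : ℤ × ℤ) : DependsOn (fun x => f (shift v x)) (boxAt v M) := by
  intro x y hxy
  refine hf fun i hi => hxy (i + v) ?_
  simp only [boxAt, Set.mem_prod, Set.mem_Ico, Prod.fst_zero, Prod.snd_zero, Prod.fst_add,
    Prod.snd_add] at hi ⊢
  omega

lemma dist_le_siteDist_boxAt {M : ℕ} (r s t : ℕ) {p q : ℤ × ℤ}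
    (hp : p ∈ boxAt (((r * M : ℕ) : ℤ), ((s * M : ℕ) : ℤ)) M)
    (hq : q ∈ boxAt (((r * M : ℕ) : ℤ), ((t * M : ℕ) : ℤ)) M) :
    Nat.dist s t ≤ siteDist p q := by
  have h1 := hp.2
  have h2 := hq.2
  simp only [Set.mem_Ico, Nat.cast_mul] at h1 h2
  have hM : (0 : ℤ) < M := by omega
  have h3 : Nat.dist s t ≤ (p.2 - q.2).natAbs := by
    rw [Nat.dist]
    rcases lt_trichotomy s t with h | h | h
    · have h4 : ((t : ℤ) - s - 1) * (M - 1) ≥ 0 := mul_nonneg (by omega) (by omega)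
      have : (t : ℤ) - s ≤ q.2 - p.2 := by nlinarith
      omega
    · omega
    · have h4 : ((s : ℤ) - t - 1) * (M - 1) ≥ 0 := mul_nonneg (by omega) (by omega)
      have : (s : ℤ) - t ≤ p.2 - q.2 := by nlinarith
      omega
  exact h3.trans (Nat.le_add_left _ _)

section RandomField

variable {A : Type*} [MeasurableSpace A]

lemma measurable_shift (v : ℤ × ℤ) : Measurable (shift (A := A) v) :=
  measurable_pi_lambda _ fun _ => measurable_pi_apply _

lemma measurable_cylSigma_of_dependsOn [Nonempty A] {g : ((ℤ × ℤ) → A) → ℝ} (hg : Measurable g)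
    {S : Set (ℤ × ℤ)} (h : DependsOn g S) : Measurable[cylSigma S] g := by
  classical
  let ext : (S → A) → (ℤ × ℤ) → A := fun y i => if hi : i ∈ S then y ⟨i, hi⟩ else
    Classical.arbitrary A
  have hext : Measurable ext := by
    refine measurable_pi_lambda _ fun i => ?_
    by_cases hi : i ∈ S
    · simpa [ext, hi] using measurable_pi_apply _
    · simp [ext, hi]
  have hcomp : g = (g ∘ ext) ∘ fun x (i : S) => x i.1 := by
    funext x
    refine h fun i hi => ?_
    simp [ext, show i ∈ S from hi]
  rw [hcomp]
  exact (hg.comp hext).comp (comap_measurable _)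

lemma abs_measure_inter_sub_le_one {Q : Measure ((ℤ × ℤ) → A)} [IsProbabilityMeasure Q]
    (U V : Set ((ℤ × ℤ) → A)) :
    |(Q (U ∩ V)).toReal - (Q U).toReal * (Q V).toReal| ≤ 1 := by
  have h : ∀ W : Set ((ℤ × ℤ) → A), 0 ≤ (Q W).toReal ∧ (Q W).toReal ≤ 1 := fun W =>
    ⟨ENNReal.toReal_nonneg, measureReal_le_one⟩
  rw [abs_le]
  constructor
  · linarith [(h (U ∩ V)).1, mul_le_one₀ (h U).2 (h V).1 (h V).2]
  · linarith [(h (U ∩ V)).2, mul_nonneg (h U).1 (h V).1]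

lemma alphaPair_le_one {Q : Measure ((ℤ × ℤ) → A)} [IsProbabilityMeasure Q]
    (S T : Set (ℤ × ℤ)) : alphaPair Q S T ≤ 1 :=
  Real.iSup_le (fun _ => abs_measure_inter_sub_le_one _ _) zero_le_one

lemma mixCoef_nonneg (Q : Measure ((ℤ × ℤ) → A)) (a b : ℕ∞) (k : ℕ) : 0 ≤ mixCoef Q a b k :=
  Real.iSup_nonneg fun _ => Real.iSup_nonneg fun _ => abs_nonneg _

lemma abs_measure_inter_sub_le_mixCoef {Q : Measure ((ℤ × ℤ) → A)} [IsProbabilityMeasure Q]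
    {a b : ℕ∞} {k : ℕ} {S T : Set (ℤ × ℤ)} (hS : S.encard ≤ a) (hT : T.encard ≤ b)
    (hST : ∀ s ∈ S, ∀ t ∈ T, k ≤ siteDist s t) {U V : Set ((ℤ × ℤ) → A)}
    (hU : MeasurableSet[cylSigma S] U) (hV : MeasurableSet[cylSigma T] V) :
    |Q.real (U ∩ V) - Q.real U * Q.real V| ≤ mixCoef Q a b k := by
  have h1 : |Q.real (U ∩ V) - Q.real U * Q.real V| ≤ alphaPair Q S T :=
    le_ciSup (f := fun p : {UV : Set ((ℤ × ℤ) → A) × Set ((ℤ × ℤ) → A) //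
        MeasurableSet[cylSigma S] UV.1 ∧ MeasurableSet[cylSigma T] UV.2} =>
        |(Q (p.1.1 ∩ p.1.2)).toReal - (Q p.1.1).toReal * (Q p.1.2).toReal|)
      ⟨1, Set.forall_mem_range.2 fun _ => abs_measure_inter_sub_le_one _ _⟩ ⟨(U, V), hU, hV⟩
  exact h1.trans <| le_ciSup (f := fun p : {ST : Set (ℤ × ℤ) × Set (ℤ × ℤ) //
      ST.1.encard ≤ a ∧ ST.2.encard ≤ b ∧ ∀ s ∈ ST.1, ∀ t ∈ ST.2, k ≤ siteDist s t} =>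
      alphaPair Q p.1.1 p.1.2)
    ⟨1, Set.forall_mem_range.2 fun _ => alphaPair_le_one _ _⟩ ⟨(S, T), hS, hT, hST⟩

lemma integral_comp_shift {Q : Measure ((ℤ × ℤ) → A)} (hstat : Stationary Q)
    {f : ((ℤ × ℤ) → A) → ℝ} (hf : Measurable f) (v : ℤ × ℤ) :
    ∫ x, f (shift v x) ∂Q = ∫ x, f x ∂Q := by
  conv_rhs => rw [← hstat v]
  rw [integral_map (measurable_shift v).aemeasurable hf.aestronglyMeasurable]

/-- Weak law of large numbers in `L²` for block functionals over the `K × K` grid of blocks. -/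
lemma integral_sq_sum_blocks_le [Nonempty A] {Q : Measure ((ℤ × ℤ) → A)} [IsProbabilityMeasure Q]
    (hstat : Stationary Q) {f : ((ℤ × ℤ) → A) → ℝ} (hf : Measurable f) {C : ℝ} (hC : 0 ≤ C)
    (hfC : ∀ x, f x ∈ Set.Icc 0 C) {M : ℕ} (hdep : DependsOn f (boxAt 0 M)) (K : ℕ) :
    ∫ x, (∑ r ∈ Finset.range K, ∑ s ∈ Finset.range K,
        (f (shift (((r * M : ℕ) : ℤ), ((s * M : ℕ) : ℤ)) x) - ∫ y, f y ∂Q)) ^ 2 ∂Q ≤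
      2 * (K : ℝ) ^ 3 * ∑ r ∈ Finset.range K, C ^ 2 * mixCoef Q ⊤ ⊤ r := by
  set e := ∫ y, f y ∂Q with he
  let v : ℕ → ℕ → ℤ × ℤ := fun r s => (((r * M : ℕ) : ℤ), ((s * M : ℕ) : ℤ))
  have hm : ∀ r s, Measurable fun x => f (shift (v r s) x) := fun r s =>
    hf.comp (measurable_shift _)
  have hbd : ∀ z, |f z - e| ≤ C + |e| := fun z => by
    have h1 := abs_sub (f z) e
    have h2 : |f z| ≤ C := by rw [abs_of_nonneg (hfC z).1]; exact (hfC z).2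
    linarith
  have hi1 : ∀ r s, Integrable (fun x => f (shift (v r s) x)) Q := fun r s =>
    Integrable.of_bound (hm r s).aestronglyMeasurable C
      (ae_of_all _ fun x => by rw [Real.norm_of_nonneg (hfC _).1]; exact (hfC _).2)
  have hi2 : ∀ r s t, Integrable
      (fun x => f (shift (v r s) x) * f (shift (v r t) x)) Q := fun r s t =>
    (hi1 r t).bdd_mul (c := C) (hm r s).aestronglyMeasurable
      (ae_of_all _ fun x => by rw [Real.norm_of_nonneg (hfC _).1]; exact (hfC _).2)
  have hi3 : ∀ r s t, Integrable
      (fun x => (f (shift (v r s) x) - e) * (f (shift (v r t) x) - e)) Q := fun r s t =>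
    ((hi1 r t).sub (integrable_const e)).bdd_mul (c := C + |e|)
      ((hm r s).sub_const e).aestronglyMeasurable (ae_of_all _ fun x => hbd _)
  have hcov : ∀ r s t, |∫ x, (f (shift (v r s) x) - e) * (f (shift (v r t) x) - e) ∂Q| ≤
      C ^ 2 * mixCoef Q ⊤ ⊤ (Nat.dist s t) := by
    intro r s t
    have e1 : ∫ x, (f (shift (v r s) x) - e) * (f (shift (v r t) x) - e) ∂Q =
        ∫ x, f (shift (v r s) x) * f (shift (v r t) x) ∂Q -
          (∫ x, f (shift (v r s) x) ∂Q) * ∫ x, f (shift (v r t) x) ∂Q := by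
      have hexp : ∀ x, (f (shift (v r s) x) - e) * (f (shift (v r t) x) - e) =
          f (shift (v r s) x) * f (shift (v r t) x) -
            (e * f (shift (v r s) x) + e * f (shift (v r t) x) - e * e) := fun x => by ring
      simp only [hexp]
      have hi4 : Integrable
          (fun x => e * f (shift (v r s) x) + e * f (shift (v r t) x)) Q :=
        ((hi1 r s).const_mul e).add ((hi1 r t).const_mul e)
      have hi5 : Integrable
          (fun x => e * f (shift (v r s) x) + e * f (shift (v r t) x) - e * e) Q :=
        hi4.sub (integrable_const _)
      rw [integral_sub (hi2 r s t) hi5, integral_sub hi4 (integrable_const _),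
        integral_add ((hi1 r s).const_mul e) ((hi1 r t).const_mul e),
        integral_const_mul, integral_const_mul, integral_comp_shift hstat hf,
        integral_comp_shift hstat hf]
      simp [← he]
    rw [e1]
    refine abs_integral_mul_sub_le (hm r s) (hm r t) hC (fun _ => hfC _) (fun _ => hfC _)
      fun α β => ?_
    refine abs_measure_inter_sub_le_mixCoef (S := boxAt (v r s) M) (T := boxAt (v r t) M)
      le_top le_top (fun p hp q hq => dist_le_siteDist_boxAt r s t hp hq) ?_ ?_
    · exact measurable_cylSigma_of_dependsOn (hm r s) (dependsOn_comp_shift hdep _)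
        measurableSet_Ici
    · exact measurable_cylSigma_of_dependsOn (hm r t) (dependsOn_comp_shift hdep _)
        measurableSet_Ici
  have hrow : ∀ r, ∫ x, (∑ s ∈ Finset.range K, (f (shift (v r s) x) - e)) ^ 2 ∂Q ≤
      2 * K * ∑ k ∈ Finset.range K, C ^ 2 * mixCoef Q ⊤ ⊤ k := fun r =>
    integral_sq_sum_le (Y := fun s x => f (shift (v r s) x) - e) (hi3 r)
      (β := fun k => C ^ 2 * mixCoef Q ⊤ ⊤ k)
      (fun k => mul_nonneg (sq_nonneg C) (mixCoef_nonneg _ _ _ _)) (hcov r) K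
  have hirow : ∀ r, Integrable
      (fun x => (∑ s ∈ Finset.range K, (f (shift (v r s) x) - e)) ^ 2) Q := fun r => by
    simp only [pow_two, Finset.sum_mul_sum]
    exact integrable_finsetSum _ fun s _ => integrable_finsetSum _ fun t _ => hi3 r s t
  calc _ ≤ ∫ x, K * ∑ r ∈ Finset.range K,
          (∑ s ∈ Finset.range K, (f (shift (v r s) x) - e)) ^ 2 ∂Q := by
        refine integral_mono_of_nonneg (ae_of_all _ fun x => sq_nonneg _)
          ((integrable_finsetSum _ fun r _ => hirow r).const_mul _) (ae_of_all _ fun x => ?_)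
        have h := sq_sum_le_card_mul_sum_sq (s := Finset.range K)
          (f := fun r => ∑ s ∈ Finset.range K, (f (shift (v r s) x) - e))
        rwa [Finset.card_range] at h
    _ = K * ∑ r ∈ Finset.range K,
          ∫ x, (∑ s ∈ Finset.range K, (f (shift (v r s) x) - e)) ^ 2 ∂Q := by
        rw [integral_const_mul, integral_finsetSum _ fun r _ => hirow r]
    _ ≤ K * ∑ r ∈ Finset.range K, (2 * K * ∑ k ∈ Finset.range K, C ^ 2 * mixCoef Q ⊤ ⊤ k) :=
        mul_le_mul_of_nonneg_left (Finset.sum_le_sum fun r _ => hrow r) (Nat.cast_nonneg K)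
    _ = _ := by
        rw [Finset.sum_const, Finset.card_range, nsmul_eq_mul]; ring

end RandomField

section Blocks

lemma Kq_mul_le (n m : ℕ) : Kq n (m + 1) * (m + 1) ≤ n := by
  have h := Nat.div_mul_le_self (n + (m + 1) - 1) (m + 1)
  rw [Kq, Nat.sub_mul]
  omega

lemma le_Kq_add_one_mul (n m : ℕ) : n ≤ (Kq n (m + 1) + 1) * (m + 1) := by
  have h := Nat.lt_div_mul_add (a := n + (m + 1) - 1) (Nat.succ_pos m)
  have h2 : (n + (m + 1) - 1) / (m + 1) ≤ Kq n (m + 1) + 1 := by rw [Kq]; omega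
  have h3 := Nat.mul_le_mul_right (m + 1) h2
  simp only [Nat.succ_eq_add_one] at h
  omega

lemma Kq_le (n m : ℕ) : Kq n (m + 1) ≤ n :=
  (Nat.le_mul_of_pos_right _ (Nat.succ_pos m)).trans (Kq_mul_le n m)

lemma tendsto_Kq_div (m : ℕ) :
    Tendsto (fun n : ℕ => (Kq n (m + 1) : ℝ) / n) atTop (nhds (1 / ((m : ℝ) + 1))) := by
  have h1 : Tendsto (fun n : ℕ => 1 / ((m : ℝ) + 1) - 1 / (n : ℝ)) atTop
      (nhds (1 / ((m : ℝ) + 1) - 0)) := tendsto_const_nhds.sub tendsto_one_div_atTop_nhds_zero_nat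
  rw [sub_zero] at h1
  have hm : (0 : ℝ) < (m : ℝ) + 1 := by positivity
  refine tendsto_of_tendsto_of_tendsto_of_le_of_le' h1 tendsto_const_nhds ?_ ?_
  · filter_upwards [eventually_gt_atTop 0] with n hn
    have hn' : (0 : ℝ) < n := by exact_mod_cast hn
    have h : (n : ℝ) ≤ (Kq n (m + 1) + 1) * (m + 1) := by exact_mod_cast le_Kq_add_one_mul n m
    rw [div_sub_div _ _ hm.ne' hn'.ne', div_le_div_iff₀ (by positivity) hn']
    nlinarith
  · filter_upwards [eventually_gt_atTop 0] with n hn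
    have hn' : (0 : ℝ) < n := by exact_mod_cast hn
    have h : (Kq n (m + 1) : ℝ) * (m + 1) ≤ n := by exact_mod_cast Kq_mul_le n m
    rw [div_le_div_iff₀ hn' hm]
    linarith

lemma tendsto_boundaryLoss_div (m : ℕ) (lmax : ℝ) :
    Tendsto (fun n : ℕ => boundaryLoss n (m + 1) lmax / (n : ℝ) ^ 2) atTop (nhds 0) := by
  have hm : (m : ℝ) + 1 ≠ 0 := by positivity
  have h : Tendsto (fun n : ℕ => (1 - ((Kq n (m + 1) : ℝ) / n) ^ 2 * ((m : ℝ) + 1) ^ 2) * lmax)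
      atTop (nhds ((1 - (1 / ((m : ℝ) + 1)) ^ 2 * ((m : ℝ) + 1) ^ 2) * lmax)) :=
    (((tendsto_Kq_div m).pow 2).mul_const _).const_sub 1 |>.mul_const lmax
  have h0 : (1 - (1 / ((m : ℝ) + 1)) ^ 2 * ((m : ℝ) + 1) ^ 2) * lmax = 0 := by field_simp; ring
  rw [h0] at h
  refine h.congr' ?_
  filter_upwards [eventually_gt_atTop 0] with n hn
  have hn' : (n : ℝ) ≠ 0 := by exact_mod_cast hn.ne'
  have hle : Kq n (m + 1) * Kq n (m + 1) * ((m + 1) * (m + 1)) ≤ n * n := by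
    calc _ = (Kq n (m + 1) * (m + 1)) * (Kq n (m + 1) * (m + 1)) := by ring
      _ ≤ n * n := Nat.mul_le_mul (Kq_mul_le n m) (Kq_mul_le n m)
  rw [boundaryLoss, Nat.cast_sub hle]
  push_cast
  field_simp

lemma sLoss_mem_Icc {A D B : Type*} [Fintype B] {l : A → D → ℝ} {lmax : ℝ}
    (hl : ∀ a d, 0 ≤ l a d ∧ l a d ≤ lmax) (S : Scandictor A D B) (x : B → A) :
    sLoss l S x ∈ Set.Icc 0 (Fintype.card B * lmax) := by
  rw [sLoss, cumLoss]
  refine ⟨Finset.sum_nonneg fun t _ => (hl _ _).1, ?_⟩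
  refine (Finset.sum_le_sum fun t _ => (hl _ _).2).trans ?_
  simp

variable {A D : Type*}

lemma dependsOn_comp_restrV (M : ℕ) (g : (Fin M × Fin M → A) → ℝ) :
    DependsOn (fun x => g (restrV M x)) (boxAt 0 M) := by
  intro x y hxy
  have : restrV M x = restrV M y := by
    funext p
    refine hxy _ ?_
    have h1 := p.1.isLt
    have h2 := p.2.isLt
    simp only [boxAt, Set.mem_prod, Set.mem_Ico, Prod.fst_zero, Prod.snd_zero]
    omega
  simp only [this]

lemma blockImage_restrV [Nonempty A] {n m a : ℕ} (ha : a < Kq n (m + 1) * Kq n (m + 1))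
    (x : ℤ × ℤ → A) :
    blockImage n (m + 1) (restrV n x) a = restrV (m + 1)
      (shift (((a / Kq n (m + 1) * (m + 1) : ℕ) : ℤ), ((a % Kq n (m + 1) * (m + 1) : ℕ) : ℤ)) x) := by
  have hK : 0 < Kq n (m + 1) := Nat.pos_of_ne_zero fun h => by simp [h] at ha
  have key : ∀ (b : ℕ) (i : Fin (m + 1)), b < Kq n (m + 1) → b * (m + 1) + i.1 < n := by
    intro b i hb
    have h1 := Kq_mul_le n m
    have h2 := Nat.mul_le_mul_right (m + 1) (Nat.succ_le_of_lt hb)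
    rw [Nat.succ_mul] at h2
    have := i.isLt
    omega
  funext p
  have h1 := key _ p.1 (Nat.div_lt_of_lt_mul ha)
  have h2 := key _ p.2 (Nat.mod_lt a hK)
  rw [blockImage, siteVal, dif_pos ⟨h1, h2⟩]
  simp only [restrV, shift]
  congr 1
  ext
  · simp only [Prod.fst_add]; push_cast; ring
  · simp only [Prod.snd_add]; push_cast; ring

lemma cumBlockLoss_blockLoss [Nonempty A] {J : Type*} (l : A → D → ℝ) (n m : ℕ)
    (S : J → Scandictor A D (Fin (m + 1) × Fin (m + 1))) (x : ℤ × ℤ → A) (j : J) :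
    cumBlockLoss (blockLoss l n (m + 1) S (restrV n x)) j (Kq n (m + 1) * Kq n (m + 1)) =
      ∑ r ∈ Finset.range (Kq n (m + 1)), ∑ s ∈ Finset.range (Kq n (m + 1)),
        sLoss l (S j) (restrV (m + 1)
          (shift (((r * (m + 1) : ℕ) : ℤ), ((s * (m + 1) : ℕ) : ℤ)) x)) := by
  rw [cumBlockLoss, sum_range_mul_eq]
  refine Finset.sum_congr rfl fun r hr => Finset.sum_congr rfl fun s hs => ?_
  have hr := Finset.mem_range.1 hr
  have hs := Finset.mem_range.1 hs
  have hlt : r * Kq n (m + 1) + s < Kq n (m + 1) * Kq n (m + 1) := by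
    have := Nat.mul_le_mul_right (Kq n (m + 1)) (Nat.succ_le_of_lt hr)
    rw [Nat.succ_mul] at this
    omega
  have hd : (r * Kq n (m + 1) + s) / Kq n (m + 1) = r := by
    rw [mul_comm, Nat.mul_add_div (by omega), Nat.div_eq_of_lt hs, add_zero]
  have hmod : (r * Kq n (m + 1) + s) % Kq n (m + 1) = s := by
    rw [mul_comm, Nat.mul_add_mod, Nat.mod_eq_of_lt hs]
  rw [blockLoss, blockImage_restrV hlt, hd, hmod]

lemma measurable_blockLoss [MeasurableSpace A] [Nonempty A] {J : Type*} {l : A → D → ℝ} {n m a : ℕ}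
    {S : J → Scandictor A D (Fin (m + 1) × Fin (m + 1))} {j : J}
    (hS : Measurable fun x : (ℤ × ℤ) → A => sLoss l (S j) (restrV (m + 1) x))
    (ha : a < Kq n (m + 1) * Kq n (m + 1)) :
    Measurable fun x => blockLoss l n (m + 1) S (restrV n x) j a := by
  simp only [blockLoss, blockImage_restrV ha]
  exact hS.comp (measurable_shift _)

lemma measurable_expWeight {𝓧 J : Type*} [MeasurableSpace 𝓧] [Fintype J] (η : ℝ)
    {bl : 𝓧 → J → ℕ → ℝ} {i : ℕ} (h : ∀ a < i, ∀ j, Measurable fun x => bl x j a) (j : J) :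
    Measurable fun x => expWeight η (bl x) i j := by
  have hc : ∀ j, Measurable fun x => Real.exp (-η * cumBlockLoss (bl x) j i) := fun j =>
    ((Finset.measurable_fun_sum _ fun a ha => h a (Finset.mem_range.1 ha) j).const_mul (-η)).exp
  exact (hc j).div (Finset.measurable_fun_sum _ fun j _ => hc j)

end Blocks

lemma lmax_nonneg_of_scandictor {A D B : Type*} [Nonempty A] [Fintype B] {l : A → D → ℝ} {lmax : ℝ}
    (hl : ∀ a d, 0 ≤ l a d ∧ l a d ≤ lmax) (S : Scandictor A D B) : 0 ≤ lmax :=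
  let h := hl (Classical.arbitrary A) (S.pred 0 Fin.elim0)
  h.1.trans h.2

/-- The lower limit of the normalized loss of the block algorithm is almost surely at most the
expected normalized loss of any fixed expert. -/
lemma ae_liminf_le_integral_sLoss {A D : Type*} [MeasurableSpace A] [Nonempty A]
    {lmax : ℝ} {l : A → D → ℝ} (hl : ∀ a d, 0 ≤ l a d ∧ l a d ≤ lmax)
    {Q : Measure ((ℤ × ℤ) → A)} [IsProbabilityMeasure Q]
    (hstat : Stationary Q) (hmix : StronglyMixing Q) {lam : ℕ} (hlam : 0 < lam) {m : ℕ}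
    {S : Fin lam → Scandictor A D (Fin (m + 1) × Fin (m + 1))}
    (hS : ∀ j, Measurable fun x : (ℤ × ℤ) → A => sLoss l (S j) (restrV (m + 1) x))
    {Ω : Type*} [MeasurableSpace Ω] {μ : Measure Ω} [IsProbabilityMeasure μ]
    {X : Ω → (ℤ × ℤ) → A} {sel : Ω → ℕ → ℕ → Fin lam} (hX : Measurable X)
    (hsel : ∀ n i, Measurable fun ω => sel ω n i)
    (hlaw : ∀ (Fs : Finset (ℕ × ℕ)) (c : ℕ × ℕ → Fin lam) (E : Set ((ℤ × ℤ) → A)),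
      MeasurableSet E →
      μ {ω | X ω ∈ E ∧ ∀ p ∈ Fs, sel ω p.1 p.2 = c p}
        = ∫⁻ x in E, ∏ p ∈ Fs,
            ENNReal.ofReal
              (expWeight (ewEta p.1 (m + 1) lmax lam)
                (blockLoss l p.1 (m + 1) S (restrV p.1 x)) p.2 (c p)) ∂Q)
    (j : Fin lam) :
    ∀ᵐ ω ∂μ, liminf (fun n =>
        (boundaryLoss n (m + 1) lmax +
          ewRealizedLoss (blockLoss l n (m + 1) S (restrV n (X ω)))
            (Kq n (m + 1) * Kq n (m + 1)) (sel ω n)) / (n : ℝ) ^ 2) atTop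
      ≤ (∫ x, sLoss l (S j) (restrV (m + 1) x) ∂Q) / ((m : ℝ) + 1) ^ 2 := by
  have : Nonempty (Fin lam) := ⟨j⟩
  have hlmax : 0 ≤ lmax := lmax_nonneg_of_scandictor hl (S j)
  set C : ℝ := ((m + 1 : ℕ) : ℝ) ^ 2 * lmax with hCdef
  have hC : 0 ≤ C := by positivity
  have hSC : ∀ i x, sLoss l (S i) x ∈ Set.Icc 0 C := fun i x => by
    have := sLoss_mem_Icc hl (S i) x
    rwa [Fintype.card_prod, Fintype.card_fin, Nat.cast_mul, ← pow_two] at this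
  set f : ((ℤ × ℤ) → A) → ℝ := fun x => sLoss l (S j) (restrV (m + 1) x) with hf
  set e := ∫ x, f x ∂Q with he
  have hXQ : μ.map X = Q := by
    ext E hE
    have := hlaw ∅ (fun _ => j) E hE
    rw [Measure.map_apply hX hE]
    simpa [Set.preimage] using this
  let K : ℕ → ℕ := fun n => Kq n (m + 1)
  let bl : ℕ → ((ℤ × ℤ) → A) → Fin lam → ℕ → ℝ := fun n x => blockLoss l n (m + 1) S (restrV n x)
  have hblC : ∀ n x i a, bl n x i a ∈ Set.Icc 0 C := fun n x i a => hSC i _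
  let w : ℕ → ℕ → Fin lam → ((ℤ × ℤ) → A) → ℝ := fun n i c x =>
    expWeight (ewEta n (m + 1) lmax lam) (bl n x) i c
  let g : ℕ → ℕ → Fin lam → ((ℤ × ℤ) → A) → ℝ := fun n i c x =>
    bl n x c i - ∑ c', w n i c' x * bl n x c' i
  have hblm : ∀ n, ∀ i < K n * K n, ∀ c, Measurable fun x => bl n x c i := fun n i hi c =>
    measurable_blockLoss (hS c) hi
  have hw : ∀ n, ∀ i < K n * K n, ∀ c, Measurable (w n i c) := fun n i hi c =>
    measurable_expWeight _ (fun a ha c => hblm n a (ha.trans hi) c) c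
  have hg : ∀ n, ∀ i < K n * K n, ∀ c, Measurable (g n i c) := fun n i hi c =>
    (hblm n i hi c).sub (Finset.measurable_fun_sum _ fun c' _ => (hw n i hi c').mul (hblm n i hi c'))
  have hgC : ∀ n i c x, |g n i c x| ≤ C := by
    intro n i c x
    have h1 := hblC n x c i
    have h2 : 0 ≤ ∑ c', w n i c' x * bl n x c' i :=
      Finset.sum_nonneg fun c' _ => mul_nonneg (expWeight_nonneg _ _ _ _) (hblC n x c' i).1
    have h3 : ∑ c', w n i c' x * bl n x c' i ≤ C := by
      calc _ ≤ ∑ c', w n i c' x * C := Finset.sum_le_sum fun c' _ =>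
            mul_le_mul_of_nonneg_left (hblC n x c' i).2 (expWeight_nonneg _ _ _ _)
        _ = C := by rw [← Finset.sum_mul, sum_expWeight, one_mul]
    rw [abs_le]
    constructor <;> simp only [g] <;> linarith [h1.1, h1.2]
  have hcen : ∀ n i x, ∑ c, w n i c x * g n i c x = 0 := by
    intro n i x
    simp only [g, mul_sub]
    rw [Finset.sum_sub_distrib, ← Finset.sum_mul, sum_expWeight, one_mul, sub_self]
  have hpair : ∀ n i k, i ≠ k → ∀ c c' E, MeasurableSet E →
      μ {ω | X ω ∈ E ∧ sel ω n i = c ∧ sel ω n k = c'} =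
        ∫⁻ x in E, ENNReal.ofReal (w n i c x * w n k c' x) ∂Q := by
    intro n i k hik c c' E hE
    have h := hlaw {(n, i), (n, k)} (fun p => if p.2 = i then c else c') E hE
    have hne : (n, i) ≠ (n, k) := fun h => hik (Prod.ext_iff.1 h).2
    simp only [Finset.prod_pair hne, Finset.mem_insert, Finset.mem_singleton, forall_eq_or_imp,
      forall_eq, if_true, if_neg hik.symm] at h
    rw [h]
    refine lintegral_congr fun x => ?_
    rw [ENNReal.ofReal_mul (expWeight_nonneg _ _ _ _)]
  let N : ℕ → Ω → ℝ := fun n ω => ∑ i ∈ Finset.range (K n * K n), g n i (sel ω n i) (X ω)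
  have hN2 : ∀ n, ∫ ω, N n ω ^ 2 ∂μ ≤ ((K n * K n : ℕ) : ℝ) * C ^ 2 := fun n =>
    integral_sq_sum_centered_le hX (hsel n) (hw n) (fun _ _ _ => expWeight_nonneg _ _ _ _)
      (fun _ _ _ => expWeight_le_one _ _ _ _) (hg n) (fun i _ => hgC n i)
      (fun i _ => hcen n i) (hpair n)
  have hNm : ∀ n, Measurable (N n) := fun n => by
    refine Finset.measurable_fun_sum _ fun i hi => ?_
    have hexp : ∀ ω, g n i (sel ω n i) (X ω) =
        ∑ c, {ω | sel ω n i = c}.indicator (fun ω => g n i c (X ω)) ω := by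
      intro ω
      simp [Set.indicator_apply]
    simp only [hexp]
    exact Finset.measurable_fun_sum _ fun c _ => ((hg n i (Finset.mem_range.1 hi) c).comp
      hX).indicator (hsel n i (measurableSet_singleton c))
  have hNb : ∀ n ω, |N n ω| ≤ ((K n * K n : ℕ) : ℝ) * C := fun n ω => by
    refine (Finset.abs_sum_le_sum_abs _ _).trans
      ((Finset.sum_le_sum fun i _ => hgC n i _ _).trans ?_)
    simp
  let R : ℕ → ((ℤ × ℤ) → A) → ℝ := fun n x =>
    ∑ r ∈ Finset.range (K n), ∑ s ∈ Finset.range (K n),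
      (f (shift (((r * (m + 1) : ℕ) : ℤ), ((s * (m + 1) : ℕ) : ℤ)) x) - e)
  have hR2 : ∀ n, ∫ x, R n x ^ 2 ∂Q ≤
      2 * (K n : ℝ) ^ 3 * ∑ r ∈ Finset.range (K n), C ^ 2 * mixCoef Q ⊤ ⊤ r := fun n =>
    integral_sq_sum_blocks_le hstat (hS j) hC (fun x => hSC j _) (dependsOn_comp_restrV _ _) (K n)
  have hRm : ∀ n, Measurable (R n) := fun n =>
    Finset.measurable_fun_sum _ fun r _ => Finset.measurable_fun_sum _ fun s _ =>
      ((hS j).comp (measurable_shift _)).sub_const e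
  have hRb : ∀ n x, |R n x| ≤ (K n : ℝ) * (K n * (C + |e|)) := fun n x => by
    have hb : ∀ z, |f z - e| ≤ C + |e| := fun z => by
      have h1 := abs_sub (f z) e
      have h2 : |f z| ≤ C := by rw [abs_of_nonneg (hSC j _).1]; exact (hSC j _).2
      linarith
    refine (Finset.abs_sum_le_sum_abs _ _).trans ((Finset.sum_le_sum fun r _ =>
      (Finset.abs_sum_le_sum_abs _ _).trans (Finset.sum_le_sum fun s _ => hb _)).trans ?_)
    simp only [Finset.sum_const, Finset.card_range, nsmul_eq_mul, le_refl]
  have hcum : ∀ n x, cumBlockLoss (bl n x) j (K n * K n) = R n x + (K n : ℝ) ^ 2 * e := fun n x => by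
    simp only [R, bl, Finset.sum_sub_distrib, hf, cumBlockLoss_blockLoss, K]
    simp
    ring
  set c₀ : ℝ := 2 * Real.sqrt (2 * Real.log lam) * ((m + 1 : ℕ) : ℝ) ^ 3 * lmax with hc₀
  refine ae_liminf_le_of_integral_sq_tendsto
    (b := fun n => boundaryLoss n (m + 1) lmax / (n : ℝ) ^ 2 +
      c₀ * (n + (m + 1 : ℕ)) / (n : ℝ) ^ 2 + ((K n : ℝ) / n) ^ 2 * e)
    (Y := fun n ω => N n ω / (n : ℝ) ^ 2) (Z := fun n ω => R n (X ω) / (n : ℝ) ^ 2)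
    ?_ ?_ ?_ ?_ ?_ ?_ ?_ ?_ ?_
  · have h1 : Tendsto (fun n : ℕ => c₀ * (n + (m + 1 : ℕ)) / (n : ℝ) ^ 2) atTop (nhds 0) := by
      have hi := tendsto_one_div_atTop_nhds_zero_nat (𝕜 := ℝ)
      have h := (hi.add ((hi.mul hi).const_mul ((m + 1 : ℕ) : ℝ))).const_mul c₀
      simp only [mul_zero, add_zero] at h
      refine h.congr' ?_
      filter_upwards [eventually_gt_atTop 0] with n hn
      have hn' : (n : ℝ) ≠ 0 := by exact_mod_cast hn.ne'
      field_simp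
    have h := ((tendsto_boundaryLoss_div m lmax).add h1).add
      (((tendsto_Kq_div m).pow 2).mul_const e)
    have hlim : 0 + 0 + (1 / ((m : ℝ) + 1)) ^ 2 * e = e / ((m : ℝ) + 1) ^ 2 := by
      rw [one_div, inv_pow]; ring
    rw [hlim] at h
    exact h
  · intro n ω
    refine div_nonneg (add_nonneg ?_ (Finset.sum_nonneg fun i _ => (hblC n (X ω) _ i).1))
      (sq_nonneg _)
    rw [boundaryLoss]
    positivity
  · exact fun n => ((hNm n).div_const _).aestronglyMeasurable
  · exact fun n => (((hRm n).comp hX).div_const _).aestronglyMeasurable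
  · refine fun n => Integrable.of_bound
      (((hNm n).div_const _).pow_const 2).aestronglyMeasurable
      ((((K n * K n : ℕ) : ℝ) * C / (n : ℝ) ^ 2) ^ 2) (ae_of_all _ fun ω => ?_)
    rw [norm_pow, norm_div, Real.norm_eq_abs, Real.norm_of_nonneg (sq_nonneg (n : ℝ))]
    exact pow_le_pow_left₀ (by positivity)
      (div_le_div_of_nonneg_right (hNb n ω) (sq_nonneg _)) 2
  · refine fun n => Integrable.of_bound
      ((((hRm n).comp hX).div_const _).pow_const 2).aestronglyMeasurable
      (((K n : ℝ) * (K n * (C + |e|)) / (n : ℝ) ^ 2) ^ 2) (ae_of_all _ fun ω => ?_)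
    rw [norm_pow, norm_div, Real.norm_eq_abs, Real.norm_of_nonneg (sq_nonneg (n : ℝ))]
    exact pow_le_pow_left₀ (by positivity)
      (div_le_div_of_nonneg_right (hRb n (X ω)) (sq_nonneg _)) 2
  · have hlim : Tendsto (fun n : ℕ => C ^ 2 * (1 / (n : ℝ) * (1 / (n : ℝ)))) atTop (nhds 0) := by
      have hi := tendsto_one_div_atTop_nhds_zero_nat (𝕜 := ℝ)
      simpa only [mul_zero] using (hi.mul hi).const_mul (C ^ 2)
    refine squeeze_zero' (Eventually.of_forall fun n => integral_nonneg fun ω => sq_nonneg _) ?_ hlim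
    filter_upwards [eventually_gt_atTop 0] with n hn
    have hn' : (0 : ℝ) < n := by exact_mod_cast hn
    simp only [div_pow]
    rw [integral_div, div_le_iff₀ (by positivity)]
    refine (hN2 n).trans ?_
    push_cast
    calc (K n : ℝ) * K n * C ^ 2 ≤ n * n * C ^ 2 := by gcongr <;> exact Kq_le n m
      _ = _ := by field_simp
  · have hlim : Tendsto
        (fun n : ℕ => 2 * ((n : ℝ)⁻¹ * ∑ r ∈ Finset.range n, C ^ 2 * mixCoef Q ⊤ ⊤ r))
        atTop (nhds 0) := by
      have h := (((hmix ⊤ ⊤).const_mul (C ^ 2)).cesaro).const_mul 2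
      simpa only [mul_zero] using h
    refine squeeze_zero' (Eventually.of_forall fun n => integral_nonneg fun ω => sq_nonneg _) ?_ hlim
    filter_upwards [eventually_gt_atTop 0] with n hn
    have hn' : (0 : ℝ) < n := by exact_mod_cast hn
    have hXR : ∫ ω, R n (X ω) ^ 2 ∂μ = ∫ x, R n x ^ 2 ∂Q := by
      rw [← hXQ, integral_map hX.aemeasurable ((hRm n).pow_const 2).aestronglyMeasurable]
    have hβ : ∀ r, 0 ≤ C ^ 2 * mixCoef Q ⊤ ⊤ r := fun r =>
      mul_nonneg (sq_nonneg C) (mixCoef_nonneg _ _ _ _)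
    simp only [div_pow]
    rw [integral_div, div_le_iff₀ (by positivity), hXR]
    refine (hR2 n).trans ?_
    have hsum : ∑ r ∈ Finset.range (K n), C ^ 2 * mixCoef Q ⊤ ⊤ r ≤
        ∑ r ∈ Finset.range n, C ^ 2 * mixCoef Q ⊤ ⊤ r :=
      Finset.sum_le_sum_of_subset_of_nonneg (Finset.range_mono (Kq_le n m)) fun r _ _ => hβ r
    calc _ ≤ 2 * (n : ℝ) ^ 3 * ∑ r ∈ Finset.range n, C ^ 2 * mixCoef Q ⊤ ⊤ r :=
          mul_le_mul (by gcongr; exact Kq_le n m) hsum (Finset.sum_nonneg fun r _ => hβ r)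
            (by positivity)
      _ = _ := by field_simp
  · intro n ω
    have hT : K n * K n ≤ n ^ 2 := by
      rw [pow_two]; exact Nat.mul_le_mul (Kq_le n m) (Kq_le n m)
    have hreg := ewExpectedLoss_ewEta_le hlam hlmax (n := n) (Nat.succ_pos m) hT
      (bl := bl n (X ω)) (fun c i _ => hblC n (X ω) c i) j
    rw [hcum] at hreg
    have hreal : ewRealizedLoss (bl n (X ω)) (K n * K n) (sel ω n) = N n ω +
        ewExpectedLoss (ewEta n (m + 1) lmax lam) (bl n (X ω)) (K n * K n) := by
      simp only [ewRealizedLoss, ewExpectedLoss, N, g, w]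
      rw [← Finset.sum_add_distrib]
      exact Finset.sum_congr rfl fun i _ => (sub_add_cancel _ _).symm
    have hle : boundaryLoss n (m + 1) lmax +
        ewRealizedLoss (bl n (X ω)) (K n * K n) (sel ω n) ≤
        boundaryLoss n (m + 1) lmax + c₀ * (n + (m + 1 : ℕ)) + (K n : ℝ) ^ 2 * e +
          N n ω + R n (X ω) := by
      rw [hreal]
      linarith
    refine (div_le_div_of_nonneg_right hle (sq_nonneg (n : ℝ))).trans ?_
    have h1 := le_abs_self (N n ω / (n : ℝ) ^ 2)
    have h2 := le_abs_self (R n (X ω) / (n : ℝ) ^ 2)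
    simp only [add_div, div_pow, div_mul_eq_mul_div] at h1 h2 ⊢
    linarith

/-- (Array sizes are `n × n`; block sizes are parameterized as `m + 1`;
the expert set used by the algorithm with block size `m + 1` is `F m`, the given set of
`lam` scandictors for `V_{m+1}`.)  For a stationary strongly mixing `Q` whose finite-set
scandictability `U_F(l,Q) = u` exists, there is `δ(m) → 0` such that on any probability
space carrying the field `X` (with law `Q`) together with the algorithm's selections —
whose joint law with `X` is specified on cylinders by the exponential-weighting
probabilities, conditionally independent across runs and blocks given `X` — the liminf of
the normalized realized loss of the algorithm with fixed block size `m + 1` is a.s. at most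
`u + δ(m)`. -/
theorem statement8 {A D : Type*} [MeasurableSpace A] [Nonempty A]
    (lmax : ℝ) (l : A → D → ℝ) (hl : ∀ a d, 0 ≤ l a d ∧ l a d ≤ lmax)
    (Q : MeasureTheory.Measure ((ℤ × ℤ) → A)) (hQp : MeasureTheory.IsProbabilityMeasure Q)
    (hstat : Stationary Q) (hmix : StronglyMixing Q)
    (lam : ℕ) (hlam : 0 < lam)
    (F : (n : ℕ) → Fin lam → Scandictor A D (Fin (n + 1) × Fin (n + 1)))
    (hFmeas : ∀ n j, Measurable fun x : (ℤ × ℤ) → A => sLoss l (F n j) (restrV (n + 1) x))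
    (u : ℝ)
    (hU : Filter.Tendsto (fun n =>
        Finset.univ.inf' ⟨⟨0, hlam⟩, Finset.mem_univ _⟩
          (fun j => ∫ x, sLoss l (F n j) (restrV (n + 1) x) / ((n : ℝ) + 1) ^ 2 ∂Q))
      Filter.atTop (nhds u)) :
    ∃ δ : ℕ → ℝ, Filter.Tendsto δ Filter.atTop (nhds 0) ∧
      ∀ m : ℕ,
      ∀ (Ω : Type) [MeasurableSpace Ω] (μ : MeasureTheory.Measure Ω),
        MeasureTheory.IsProbabilityMeasure μ →
      ∀ (X : Ω → (ℤ × ℤ) → A) (sel : Ω → ℕ → ℕ → Fin lam),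
        Measurable X →
        (∀ n i, Measurable fun ω => sel ω n i) →
        (∀ (Fs : Finset (ℕ × ℕ)) (c : ℕ × ℕ → Fin lam) (E : Set ((ℤ × ℤ) → A)),
          MeasurableSet E →
          μ {ω | X ω ∈ E ∧ ∀ p ∈ Fs, sel ω p.1 p.2 = c p}
            = ∫⁻ x in E, ∏ p ∈ Fs,
                ENNReal.ofReal
                  (expWeight (ewEta p.1 (m + 1) lmax lam)
                    (blockLoss l p.1 (m + 1) (F m) (restrV p.1 x)) p.2 (c p)) ∂Q) →
        ∀ᵐ ω ∂μ,
          Filter.liminf (fun n =>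
              (boundaryLoss n (m + 1) lmax +
                ewRealizedLoss (blockLoss l n (m + 1) (F m) (restrV n (X ω)))
                  (Kq n (m + 1) * Kq n (m + 1)) (sel ω n)) / (n : ℝ) ^ 2)
            Filter.atTop
          ≤ u + δ m := by
  have hmin : ∀ m : ℕ, ∃ j, Finset.univ.inf' ⟨⟨0, hlam⟩, Finset.mem_univ _⟩
      (fun j => ∫ x, sLoss l (F m j) (restrV (m + 1) x) / ((m : ℝ) + 1) ^ 2 ∂Q) =
      ∫ x, sLoss l (F m j) (restrV (m + 1) x) / ((m : ℝ) + 1) ^ 2 ∂Q := fun m => by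
    obtain ⟨j, -, hj⟩ := Finset.exists_mem_eq_inf' (s := Finset.univ)
      ⟨⟨0, hlam⟩, Finset.mem_univ _⟩
      (fun j => ∫ x, sLoss l (F m j) (restrV (m + 1) x) / ((m : ℝ) + 1) ^ 2 ∂Q)
    exact ⟨j, hj⟩
  refine ⟨_, by simpa using hU.sub_const u, ?_⟩
  intro m Ω _ μ hμ X sel hX hsel hlaw
  obtain ⟨j, hj⟩ := hmin m
  rw [add_sub_cancel, hj, integral_div]
  exact ae_liminf_le_integral_sLoss hl hstat hmix hlam (hFmeas m) hX hsel hlaw j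

end Scandiction
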